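/- Let t, d ∈ ℚ₂ be nonzero with v(t) ≥ 1; write n_t = v(t) and n_d = v(d). (i) Let e be an even integer and x, y, l₁, l₂ ∈ 2^{e/2}ℤ₂. If n_d − n_t = −1 and (2d)⁻¹y − x = t·l₁ and −2d·x − y = t·l₂, then x·y·t⁻¹ ∈ 2^e ℤ₂; if n_d + n_t = 1 and 2d⁻¹y − x = t·l₁ and −(d/2)·x − y = t·l₂, then x·y·t⁻¹ ∈ 2^e ℤ₂. (ii) Let e be an odd integer, x, l₁ ∈ 2^{(e+1)/2}ℤ₂ and y, l₂ ∈ 2^{(e−1)/2}ℤ₂. If n_d − n_t = −2 and (2d)⁻¹y − x = t·l₁ and −2d·x − y = t·l₂, then x·y·t⁻¹ ∈ 2^e ℤ₂; if n_d + n_t = 0 and 2d⁻¹y − x = t·l₁ and −(d/2)·x − y = t·l₂, then x·y·t⁻¹ ∈ 2^e ℤ₂. -/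

import Mathlib

/-- `x ∈ 2^e ℤ₂` inside `ℚ₂`. -/
def inTwoPowLattice (e : ℤ) (x : ℚ_[2]) : Prop :=
  ∃ z : ℤ_[2], x = (2 : ℚ_[2]) ^ e * (z : ℚ_[2])

/- `Padic.valuation` is the additive 2-adic valuation `v` on `ℚ₂` with `v(2) = 1`. -/

namespace inTwoPowLattice

theorem of_le_valuation {n : ℤ} {x : ℚ_[2]} (h : n ≤ x.valuation) : inTwoPowLattice n x := by
  rcases eq_or_ne x 0 with rfl | hx
  · exact ⟨0, by simp⟩
  have h2 : (2 : ℚ_[2]) ^ n ≠ 0 := zpow_ne_zero _ two_ne_zero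
  refine ⟨⟨x / 2 ^ n, ?_⟩, (mul_div_cancel₀ x h2).symm⟩
  have hnorm : ‖(2 : ℚ_[2]) ^ n‖ = 2 ^ (-n) := by simpa using Padic.norm_p_zpow (p := 2) n
  rw [norm_div, hnorm, Padic.norm_eq_zpow_neg_valuation hx, div_le_one (by positivity)]
  exact zpow_le_zpow_right₀ (by norm_num) (neg_le_neg h)

theorem add {n : ℤ} {x y : ℚ_[2]} (hx : inTwoPowLattice n x) (hy : inTwoPowLattice n y) :
    inTwoPowLattice n (x + y) := by
  obtain ⟨a, rfl⟩ := hx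
  obtain ⟨b, rfl⟩ := hy
  exact ⟨a + b, by push_cast; ring⟩

theorem neg {n : ℤ} {x : ℚ_[2]} (hx : inTwoPowLattice n x) : inTwoPowLattice n (-x) := by
  obtain ⟨a, rfl⟩ := hx
  exact ⟨-a, by push_cast; ring⟩

theorem mul {m n : ℤ} {x y : ℚ_[2]} (hx : inTwoPowLattice m x) (hy : inTwoPowLattice n y) :
    inTwoPowLattice (m + n) (x * y) := by
  obtain ⟨a, rfl⟩ := hx
  obtain ⟨b, rfl⟩ := hy
  exact ⟨a * b, by rw [zpow_add₀ two_ne_zero]; push_cast; ring⟩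

/-- If `x, l ∈ 2^m ℤ₂`, `t ∈ ℤ₂` and `v(c) = v(t) + j`, then `c (x + t l) t⁻¹ ∈ 2^(m+j) ℤ₂`. -/
theorem mul_add_mul_inv {m j : ℤ} {c t x l : ℚ_[2]} (hc : c ≠ 0) (ht : t ≠ 0)
    (hvt : 0 ≤ t.valuation) (hv : c.valuation = t.valuation + j)
    (hx : inTwoPowLattice m x) (hl : inTwoPowLattice m l) :
    inTwoPowLattice (m + j) (c * (x + t * l) * t⁻¹) := by
  have htl : inTwoPowLattice m (t * l) := by simpa using (of_le_valuation hvt).mul hl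
  have hct : inTwoPowLattice j (c * t⁻¹) := by
    apply of_le_valuation
    rw [Padic.valuation_mul hc (inv_ne_zero ht), Padic.valuation_inv, hv]
    omega
  convert (hx.add htl).mul hct using 1
  ring

end inTwoPowLattice

theorem Padic.valuation_two_mul {d : ℚ_[2]} (hd : d ≠ 0) :
    (2 * d).valuation = d.valuation + 1 := by
  have h2 : (2 : ℚ_[2]).valuation = 1 := by simp
  rw [Padic.valuation_mul two_ne_zero hd, h2, add_comm]

/-- If `x, l ∈ 2^m ℤ₂` and `(2d)⁻¹ y - x = t l` with `v(2d) = v(t) + j`,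
then `x y t⁻¹ ∈ 2^(2m+j) ℤ₂`. -/
theorem inTwoPowLattice_of_two_mul_inv {m j : ℤ} {t d x y l : ℚ_[2]} (ht : t ≠ 0) (hd : d ≠ 0)
    (hvt : 0 ≤ t.valuation) (hv : d.valuation + 1 = t.valuation + j)
    (hx : inTwoPowLattice m x) (hl : inTwoPowLattice m l) (h : (2 * d)⁻¹ * y - x = t * l) :
    inTwoPowLattice (m + (m + j)) (x * y * t⁻¹) := by
  have h2d : 2 * d ≠ 0 := mul_ne_zero two_ne_zero hd
  have hy : y = 2 * d * (x + t * l) := by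
    rw [← h, add_sub_cancel, mul_inv_cancel_left₀ h2d]
  have hyt := inTwoPowLattice.mul_add_mul_inv h2d ht hvt
    ((Padic.valuation_two_mul hd).trans hv) hx hl
  rw [← hy] at hyt
  rw [mul_assoc]
  exact hx.mul hyt

/-- If `y, l ∈ 2^m ℤ₂` and `-(d/2) x - y = t l` with `v(2 d⁻¹) = v(t) + j`,
then `x y t⁻¹ ∈ 2^(2m+j) ℤ₂`. -/
theorem inTwoPowLattice_of_neg_div_two {m j : ℤ} {t d x y l : ℚ_[2]} (ht : t ≠ 0) (hd : d ≠ 0)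
    (hvt : 0 ≤ t.valuation) (hv : -d.valuation + 1 = t.valuation + j)
    (hy : inTwoPowLattice m y) (hl : inTwoPowLattice m l) (h : -(d / 2) * x - y = t * l) :
    inTwoPowLattice (m + (m + j)) (x * y * t⁻¹) := by
  have hd' : d⁻¹ ≠ 0 := inv_ne_zero hd
  have hx : x = -(2 * d⁻¹ * (y + t * l)) := by
    rw [← h]
    field_simp
    ring
  have hxt := (inTwoPowLattice.mul_add_mul_inv (mul_ne_zero two_ne_zero hd') ht hvt
    (by rw [Padic.valuation_two_mul hd', Padic.valuation_inv, hv]) hy hl).neg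
  rw [← neg_mul, ← hx] at hxt
  rw [mul_comm x, mul_assoc]
  exact hy.mul hxt

theorem stmt_19 (t d : ℚ_[2]) (ht : t ≠ 0) (hd : d ≠ 0) (hvt : 1 ≤ t.valuation) :
    (∀ e : ℤ, Even e → ∀ x y l₁ l₂ : ℚ_[2],
      inTwoPowLattice (e / 2) x → inTwoPowLattice (e / 2) y →
      inTwoPowLattice (e / 2) l₁ → inTwoPowLattice (e / 2) l₂ →
      ((d.valuation - t.valuation = -1 →
          (2 * d)⁻¹ * y - x = t * l₁ → -(2 * d) * x - y = t * l₂ →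
          inTwoPowLattice e (x * y * t⁻¹)) ∧
       (d.valuation + t.valuation = 1 →
          2 * d⁻¹ * y - x = t * l₁ → -(d / 2) * x - y = t * l₂ →
          inTwoPowLattice e (x * y * t⁻¹)))) ∧
    (∀ e : ℤ, Odd e → ∀ x y l₁ l₂ : ℚ_[2],
      inTwoPowLattice ((e + 1) / 2) x → inTwoPowLattice ((e - 1) / 2) y →
      inTwoPowLattice ((e + 1) / 2) l₁ → inTwoPowLattice ((e - 1) / 2) l₂ →
      ((d.valuation - t.valuation = -2 →
          (2 * d)⁻¹ * y - x = t * l₁ → -(2 * d) * x - y = t * l₂ →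
          inTwoPowLattice e (x * y * t⁻¹)) ∧
       (d.valuation + t.valuation = 0 →
          2 * d⁻¹ * y - x = t * l₁ → -(d / 2) * x - y = t * l₂ →
          inTwoPowLattice e (x * y * t⁻¹)))) := by
  have hvt' : 0 ≤ t.valuation := by omega
  refine ⟨?_, ?_⟩
  · rintro e ⟨k, rfl⟩ x y l₁ l₂ hx hy hl₁ hl₂
    rw [show (k + k) / 2 = k by omega] at hx hy hl₁ hl₂
    refine ⟨fun hv h₁ _ => ?_, fun hv _ h₂ => ?_⟩
    · simpa using inTwoPowLattice_of_two_mul_inv (j := 0) ht hd hvt' (by omega) hx hl₁ h₁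
    · simpa using inTwoPowLattice_of_neg_div_two (j := 0) ht hd hvt' (by omega) hy hl₂ h₂
  · rintro e ⟨k, rfl⟩ x y l₁ l₂ hx hy hl₁ hl₂
    rw [show (2 * k + 1 + 1) / 2 = k + 1 by omega] at hx hl₁
    rw [show (2 * k + 1 - 1) / 2 = k by omega] at hy hl₂
    refine ⟨fun hv h₁ _ => ?_, fun hv _ h₂ => ?_⟩
    · convert inTwoPowLattice_of_two_mul_inv (j := -1) ht hd hvt' (by omega) hx hl₁ h₁ using 1
      ring
    · convert inTwoPowLattice_of_neg_div_two (j := 1) ht hd hvt' (by omega) hy hl₂ h₂ using 1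
      ring
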